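/- Let φ ∈ L¹((0,∞)). Then (1) ‖Tφ(·;t)‖_{L¹((0,∞))} → 0 as t ↓ 0, and (2) the function (x,t) ↦ Tφ(x;t) satisfies the heat equation ∂_t Tφ(x;t) = ∂_x² Tφ(x;t) for all x ∈ (0,∞) and t ∈ (0,∞). -/

import Mathlib

open MeasureTheory

/-- `Tφ(x;t) = (4πt)^{-1/2} ∫₀^∞ e^{-(x+y)²/(4t)} φ(y) dy`. -/
noncomputable def Theat (φ : ℝ → ℝ) (x t : ℝ) : ℝ :=
  (Real.sqrt (4 * Real.pi * t))⁻¹ *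
    ∫ y in Set.Ioi (0:ℝ), Real.exp (-(x + y) ^ 2 / (4 * t)) * φ y

lemma mul_exp_neg_le_one (v : ℝ) : v * Real.exp (-v) ≤ 1 := by
  have h := Real.add_one_le_exp v
  have h1 : Real.exp v * Real.exp (-v) = 1 := by rw [← Real.exp_add]; simp
  nlinarith [Real.exp_pos (-v)]

lemma sq_mul_exp_neg_sq_div_le (u : ℝ) {t : ℝ} (ht : 0 < t) :
    u ^ 2 * Real.exp (-u ^ 2 / (4 * t)) ≤ 4 * t := by
  have h := mul_exp_neg_le_one (u ^ 2 / (4 * t))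
  rw [← neg_div, div_mul_eq_mul_div, div_le_one (by positivity)] at h
  exact h

lemma exp_neg_sq_div_le_one (u : ℝ) {t : ℝ} (ht : 0 < t) :
    Real.exp (-u ^ 2 / (4 * t)) ≤ 1 :=
  Real.exp_le_one_iff.2 (div_nonpos_of_nonpos_of_nonneg (by nlinarith [sq_nonneg u]) (by positivity))

lemma abs_mul_exp_neg_sq_div_le (u : ℝ) {t : ℝ} (ht : 0 < t) :
    |u| * Real.exp (-u ^ 2 / (4 * t)) ≤ 1 + 4 * t := by
  have h1 := sq_mul_exp_neg_sq_div_le u ht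
  have h2 := exp_neg_sq_div_le_one u ht
  have h3 : |u| ≤ 1 + u ^ 2 := by nlinarith [sq_abs u, sq_nonneg (|u| - 1)]
  nlinarith [mul_le_mul_of_nonneg_right h3 (Real.exp_pos (-u ^ 2 / (4 * t))).le]

/-- A bounded continuous function times an integrable function is integrable. -/
lemma integrableOn_continuous_mul_of_bound {φ : ℝ → ℝ} {S : Set ℝ} (hφ : IntegrableOn φ S)
    {k : ℝ → ℝ} (hk : Continuous k) {C : ℝ} (hC : ∀ y, |k y| ≤ C) :
    IntegrableOn (fun y => k y * φ y) S :=
  Integrable.bdd_mul hφ hk.aestronglyMeasurable (Filter.Eventually.of_forall hC)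

/-- Differentiation of `p ↦ ∫ k(p,y) φ(y) dy` when `∂ₚ k` is locally uniformly bounded. -/
lemma hasDerivAt_setIntegral_kernel_mul {φ : ℝ → ℝ} {S : Set ℝ} (hφ : IntegrableOn φ S)
    {k k' : ℝ → ℝ → ℝ} {p₀ B C : ℝ} {s : Set ℝ} (hs : s ∈ nhds p₀)
    (hk : ∀ p, Continuous (k p)) (hk' : Continuous (k' p₀))
    (hB : ∀ y, |k p₀ y| ≤ B) (hC : ∀ p ∈ s, ∀ y, |k' p y| ≤ C)
    (hd : ∀ p ∈ s, ∀ y, HasDerivAt (fun q => k q y) (k' p y) p) :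
    HasDerivAt (fun p => ∫ y in S, k p y * φ y) (∫ y in S, k' p₀ y * φ y) p₀ := by
  refine (hasDerivAt_integral_of_dominated_loc_of_deriv_le
    (F := fun p y => k p y * φ y) (F' := fun p y => k' p y * φ y)
    (bound := fun y => C * |φ y|) hs ?_ ?_ ?_ ?_ ?_ ?_).2
  · exact Filter.Eventually.of_forall fun p =>
      (hk p).aestronglyMeasurable.mul hφ.aestronglyMeasurable
  · exact integrableOn_continuous_mul_of_bound hφ (hk p₀) hB
  · exact hk'.aestronglyMeasurable.mul hφ.aestronglyMeasurable
  · refine Filter.Eventually.of_forall fun y p hp => ?_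
    rw [Real.norm_eq_abs, abs_mul]
    exact mul_le_mul_of_nonneg_right (hC p hp y) (abs_nonneg _)
  · exact hφ.abs.const_mul C
  · exact Filter.Eventually.of_forall fun y p hp => (hd p hp y).mul_const _

lemma hasDerivAt_exp_neg_sq_div_space (y w : ℝ) {t : ℝ} (ht : 0 < t) :
    HasDerivAt (fun w => Real.exp (-(w + y) ^ 2 / (4 * t)))
      (-(w + y) / (2 * t) * Real.exp (-(w + y) ^ 2 / (4 * t))) w := by
  have h : HasDerivAt (fun w => -(w + y) ^ 2 / (4 * t)) (-(w + y) / (2 * t)) w :=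
    ((((hasDerivAt_id' w).add_const y).pow 2).neg.div_const (4 * t)).congr_deriv
      (by simp; field_simp; ring)
  exact h.exp.congr_deriv (mul_comm _ _)

lemma hasDerivAt_mul_exp_neg_sq_div_space (y w : ℝ) {t : ℝ} (ht : 0 < t) :
    HasDerivAt (fun w => -(w + y) / (2 * t) * Real.exp (-(w + y) ^ 2 / (4 * t)))
      (((w + y) ^ 2 / (4 * t ^ 2) - 1 / (2 * t)) * Real.exp (-(w + y) ^ 2 / (4 * t))) w := by
  have h : HasDerivAt (fun w => -(w + y) / (2 * t)) (-1 / (2 * t)) w :=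
    ((hasDerivAt_id' w).add_const y).neg.div_const (2 * t)
  refine (h.mul (hasDerivAt_exp_neg_sq_div_space y w ht)).congr_deriv ?_
  generalize Real.exp (-(w + y) ^ 2 / (4 * t)) = e
  field_simp
  ring

lemma hasDerivAt_exp_neg_sq_div_time (u : ℝ) {t : ℝ} (ht : 0 < t) :
    HasDerivAt (fun s => Real.exp (-u ^ 2 / (4 * s)))
      (u ^ 2 / (4 * t ^ 2) * Real.exp (-u ^ 2 / (4 * t))) t := by
  have h : HasDerivAt (fun s => -u ^ 2 / (4 * s)) (u ^ 2 / (4 * t ^ 2)) t :=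
    ((hasDerivAt_const t (-u ^ 2)).div ((hasDerivAt_id' t).const_mul 4)
      (by positivity)).congr_deriv (by field_simp; ring)
  exact h.exp.congr_deriv (mul_comm _ _)

lemma hasDerivAt_inv_sqrt_four_pi_mul {t : ℝ} (ht : 0 < t) :
    HasDerivAt (fun s => (Real.sqrt (4 * Real.pi * s))⁻¹)
      (-(1 / (2 * t)) * (Real.sqrt (4 * Real.pi * t))⁻¹) t := by
  have hp : 0 < 4 * Real.pi * t := by positivity
  have hpos := Real.sqrt_pos.2 hp
  refine ((((hasDerivAt_id' t).const_mul (4 * Real.pi)).sqrt hp.ne').inv hpos.ne').congr_deriv ?_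
  rw [Real.sq_sqrt hp.le]
  field_simp

lemma abs_exp_neg_sq_div_le (u : ℝ) {t : ℝ} (ht : 0 < t) :
    |Real.exp (-u ^ 2 / (4 * t))| ≤ 1 := by
  rw [abs_of_pos (Real.exp_pos _)]
  exact exp_neg_sq_div_le_one u ht

lemma abs_space_deriv_le (u : ℝ) {t : ℝ} (ht : 0 < t) :
    |-u / (2 * t) * Real.exp (-u ^ 2 / (4 * t))| ≤ (1 + 4 * t) / (2 * t) := by
  rw [abs_mul, abs_div, abs_neg, Real.abs_exp, abs_of_pos (by positivity : 0 < 2 * t),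
    div_mul_eq_mul_div]
  gcongr
  exact abs_mul_exp_neg_sq_div_le u ht

lemma abs_time_deriv_le (u : ℝ) {t : ℝ} (ht : 0 < t) :
    |u ^ 2 / (4 * t ^ 2) * Real.exp (-u ^ 2 / (4 * t))| ≤ 1 / t := by
  rw [abs_of_nonneg (by positivity), div_mul_eq_mul_div, div_le_div_iff₀ (by positivity) ht]
  nlinarith [mul_le_mul_of_nonneg_right (sq_mul_exp_neg_sq_div_le u ht) ht.le]

lemma abs_second_space_deriv_le (u : ℝ) {t : ℝ} (ht : 0 < t) :
    |(u ^ 2 / (4 * t ^ 2) - 1 / (2 * t)) * Real.exp (-u ^ 2 / (4 * t))| ≤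
      1 / t + 1 / (2 * t) := by
  rw [sub_mul]
  refine (abs_sub _ _).trans (add_le_add (abs_time_deriv_le u ht) ?_)
  rw [abs_mul, abs_of_pos (by positivity : 0 < 1 / (2 * t))]
  exact mul_le_of_le_one_right (by positivity) (abs_exp_neg_sq_div_le u ht)

lemma hasDerivAt_Theat_space {φ : ℝ → ℝ} (hφ : IntegrableOn φ (Set.Ioi 0))
    (w : ℝ) {t : ℝ} (ht : 0 < t) :
    HasDerivAt (fun w => Theat φ w t)
      ((Real.sqrt (4 * Real.pi * t))⁻¹ * ∫ y in Set.Ioi (0:ℝ),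
        (-(w + y) / (2 * t) * Real.exp (-(w + y) ^ 2 / (4 * t))) * φ y) w :=
  (hasDerivAt_setIntegral_kernel_mul hφ (s := Set.univ) Filter.univ_mem
    (k := fun w y => Real.exp (-(w + y) ^ 2 / (4 * t)))
    (k' := fun w y => -(w + y) / (2 * t) * Real.exp (-(w + y) ^ 2 / (4 * t)))
    (p₀ := w) (fun p => by fun_prop) (by fun_prop) (fun y => abs_exp_neg_sq_div_le _ ht)
    (fun p _ y => abs_space_deriv_le _ ht)
    (fun p _ y => hasDerivAt_exp_neg_sq_div_space y p ht)).const_mul _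

lemma deriv_deriv_Theat_space {φ : ℝ → ℝ} (hφ : IntegrableOn φ (Set.Ioi 0))
    (x : ℝ) {t : ℝ} (ht : 0 < t) :
    deriv (deriv (fun w => Theat φ w t)) x =
      (Real.sqrt (4 * Real.pi * t))⁻¹ * ∫ y in Set.Ioi (0:ℝ),
        (((x + y) ^ 2 / (4 * t ^ 2) - 1 / (2 * t)) *
          Real.exp (-(x + y) ^ 2 / (4 * t))) * φ y := by
  rw [show deriv (fun w => Theat φ w t) = _ from
    funext fun w => (hasDerivAt_Theat_space hφ w ht).deriv]
  exact ((hasDerivAt_setIntegral_kernel_mul hφ (s := Set.univ) Filter.univ_mem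
    (k := fun w y => -(w + y) / (2 * t) * Real.exp (-(w + y) ^ 2 / (4 * t)))
    (k' := fun w y => ((w + y) ^ 2 / (4 * t ^ 2) - 1 / (2 * t)) *
      Real.exp (-(w + y) ^ 2 / (4 * t)))
    (p₀ := x) (fun p => by fun_prop) (by fun_prop) (fun y => abs_space_deriv_le _ ht)
    (fun p _ y => abs_second_space_deriv_le _ ht)
    (fun p _ y => hasDerivAt_mul_exp_neg_sq_div_space y p ht)).const_mul _).deriv

lemma hasDerivAt_Theat_time {φ : ℝ → ℝ} (hφ : IntegrableOn φ (Set.Ioi 0))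
    (x : ℝ) {t : ℝ} (ht : 0 < t) :
    HasDerivAt (fun s => Theat φ x s) (deriv (deriv (fun w => Theat φ w t)) x) t := by
  have hI := hasDerivAt_setIntegral_kernel_mul hφ (p₀ := t) (s := Set.Ioi (t / 2))
    (Ioi_mem_nhds (by linarith)) (C := 1 / (t / 2))
    (k := fun s y => Real.exp (-(x + y) ^ 2 / (4 * s)))
    (k' := fun s y => (x + y) ^ 2 / (4 * s ^ 2) * Real.exp (-(x + y) ^ 2 / (4 * s)))
    (fun p => by fun_prop) (by fun_prop) (fun y => abs_exp_neg_sq_div_le _ ht)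
    (fun p hp y => by
      have hp' : t / 2 < p := hp
      exact (abs_time_deriv_le _ (by linarith)).trans
        (one_div_le_one_div_of_le (by linarith) hp'.le))
    (fun p hp y => by
      have hp' : t / 2 < p := hp
      exact hasDerivAt_exp_neg_sq_div_time (x + y) (by linarith))
  rw [deriv_deriv_Theat_space hφ x ht]
  refine ((hasDerivAt_inv_sqrt_four_pi_mul ht).mul hI).congr_deriv ?_
  have h1 : IntegrableOn (fun y => ((x + y) ^ 2 / (4 * t ^ 2) *
      Real.exp (-(x + y) ^ 2 / (4 * t))) * φ y) (Set.Ioi 0) :=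
    integrableOn_continuous_mul_of_bound hφ (by fun_prop) (fun y => abs_time_deriv_le _ ht)
  have h2 : IntegrableOn (fun y => Real.exp (-(x + y) ^ 2 / (4 * t)) * φ y) (Set.Ioi 0) :=
    integrableOn_continuous_mul_of_bound hφ (by fun_prop) (fun y => abs_exp_neg_sq_div_le _ ht)
  have h3 : ∫ y in Set.Ioi (0:ℝ), (((x + y) ^ 2 / (4 * t ^ 2) - 1 / (2 * t)) *
        Real.exp (-(x + y) ^ 2 / (4 * t))) * φ y =
      (∫ y in Set.Ioi (0:ℝ), ((x + y) ^ 2 / (4 * t ^ 2) *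
        Real.exp (-(x + y) ^ 2 / (4 * t))) * φ y) -
      1 / (2 * t) * ∫ y in Set.Ioi (0:ℝ), Real.exp (-(x + y) ^ 2 / (4 * t)) * φ y := by
    rw [← integral_const_mul, ← integral_sub h1 (h2.const_mul _)]
    congr 1
    ext y
    ring
  rw [h3]
  ring

lemma abs_Theat_le {φ : ℝ → ℝ} (hφ : IntegrableOn φ (Set.Ioi 0))
    {x t : ℝ} (hx : 0 < x) (ht : 0 < t) :
    |Theat φ x t| ≤ (Real.sqrt (4 * Real.pi * t))⁻¹ *
      (∫ y in Set.Ioi (0:ℝ), Real.exp (-y ^ 2 / (4 * t)) * |φ y|) *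
        Real.exp (-(1 / (4 * t)) * x ^ 2) := by
  rw [Theat, abs_mul, abs_of_nonneg (by positivity), mul_assoc (Real.sqrt _)⁻¹]
  gcongr
  rw [← integral_mul_const, ← Real.norm_eq_abs]
  refine norm_integral_le_of_norm_le ?_ ?_
  · exact Integrable.mul_const (integrableOn_continuous_mul_of_bound hφ.abs (by fun_prop)
      (fun y => abs_exp_neg_sq_div_le _ ht)) _
  · refine (ae_restrict_iff' measurableSet_Ioi).2 (Filter.Eventually.of_forall fun y hy => ?_)
    have hy' : 0 < y := hy
    rw [Real.norm_eq_abs, abs_mul, Real.abs_exp, mul_right_comm, ← Real.exp_add]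
    gcongr
    rw [show -y ^ 2 / (4 * t) + -(1 / (4 * t)) * x ^ 2 = -(x ^ 2 + y ^ 2) / (4 * t) by ring]
    gcongr
    nlinarith [mul_pos hx hy']

lemma integral_abs_Theat_le {φ : ℝ → ℝ} (hφ : IntegrableOn φ (Set.Ioi 0))
    {t : ℝ} (ht : 0 < t) :
    ∫ x in Set.Ioi (0:ℝ), |Theat φ x t| ≤
      (∫ y in Set.Ioi (0:ℝ), Real.exp (-y ^ 2 / (4 * t)) * |φ y|) / 2 := by
  have hb : 0 < 1 / (4 * t) := by positivity
  have hp : 0 < 4 * Real.pi * t := by positivity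
  calc ∫ x in Set.Ioi (0:ℝ), |Theat φ x t|
      ≤ ∫ x in Set.Ioi (0:ℝ), (Real.sqrt (4 * Real.pi * t))⁻¹ *
          (∫ y in Set.Ioi (0:ℝ), Real.exp (-y ^ 2 / (4 * t)) * |φ y|) *
            Real.exp (-(1 / (4 * t)) * x ^ 2) := by
        refine integral_mono_of_nonneg (Filter.Eventually.of_forall fun x => abs_nonneg _)
          ((integrable_exp_neg_mul_sq hb).integrableOn.const_mul _) ?_
        exact (ae_restrict_iff' measurableSet_Ioi).2
          (Filter.Eventually.of_forall fun x hx => abs_Theat_le hφ hx ht)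
    _ = _ := by
        rw [integral_const_mul, integral_gaussian_Ioi,
          show Real.pi / (1 / (4 * t)) = 4 * Real.pi * t by field_simp]
        have := (Real.sqrt_pos.2 hp).ne'
        field_simp

lemma tendsto_integral_exp_neg_sq_div_mul_abs {φ : ℝ → ℝ} (hφ : IntegrableOn φ (Set.Ioi 0)) :
    Filter.Tendsto (fun t => ∫ y in Set.Ioi (0:ℝ), Real.exp (-y ^ 2 / (4 * t)) * |φ y|)
      (nhdsWithin 0 (Set.Ioi 0)) (nhds 0) := by
  rw [show nhds (0:ℝ) = nhds (∫ y in Set.Ioi (0:ℝ), (0:ℝ)) by rw [integral_zero]]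
  refine tendsto_integral_filter_of_dominated_convergence
    (F := fun t y => Real.exp (-y ^ 2 / (4 * t)) * |φ y|) (fun y => |φ y|) ?_ ?_ hφ.abs ?_
  · exact Filter.Eventually.of_forall fun t =>
      Continuous.aestronglyMeasurable (by fun_prop) |>.mul hφ.abs.aestronglyMeasurable
  · filter_upwards [self_mem_nhdsWithin] with t ht
    refine Filter.Eventually.of_forall fun y => ?_
    rw [norm_mul, Real.norm_eq_abs, Real.norm_eq_abs, abs_abs]
    exact mul_le_of_le_one_left (abs_nonneg _) (abs_exp_neg_sq_div_le y ht)
  · refine (ae_restrict_iff' measurableSet_Ioi).2 (Filter.Eventually.of_forall fun y hy => ?_)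
    have hy' : 0 < y := hy
    have hlim : Filter.Tendsto (fun t => -y ^ 2 / (4 * t)) (nhdsWithin 0 (Set.Ioi 0))
        Filter.atBot := by
      refine ((tendsto_inv_nhdsGT_zero (𝕜 := ℝ)).const_mul_atTop_of_neg
        (r := -y ^ 2 / 4) (by nlinarith [pow_pos hy' 2])).congr fun t => ?_
      rw [div_mul_eq_div_div, div_eq_mul_inv (-y ^ 2 / 4)]
    simpa using (Real.tendsto_exp_atBot.comp hlim).mul_const |φ y|

/-- Lemma 5.2 (3),(4): `‖Tφ(⋅;t)‖_{L¹} → 0` as `t ↓ 0`, and `Tφ` satisfies the heat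
equation `∂_t Tφ = ∂_x² Tφ` on `(0,∞) × (0,∞)`. -/
theorem Theat_tendsto_zero_and_heat_equation
    (φ : ℝ → ℝ) (hφ : IntegrableOn φ (Set.Ioi 0)) :
    Filter.Tendsto (fun t => ∫ x in Set.Ioi (0:ℝ), |Theat φ x t|)
      (nhdsWithin 0 (Set.Ioi 0)) (nhds 0) ∧
    ∀ x ∈ Set.Ioi (0:ℝ), ∀ t ∈ Set.Ioi (0:ℝ),
      HasDerivAt (fun s => Theat φ x s)
        (deriv (deriv (fun w => Theat φ w t)) x) t := by
  refine ⟨?_, fun x _ t ht => hasDerivAt_Theat_time hφ x ht⟩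
  have h := (tendsto_integral_exp_neg_sq_div_mul_abs hφ).div_const 2
  rw [zero_div] at h
  refine tendsto_of_tendsto_of_tendsto_of_le_of_le' tendsto_const_nhds h
    (Filter.Eventually.of_forall fun t => integral_nonneg fun x => abs_nonneg _) ?_
  filter_upwards [self_mem_nhdsWithin] with t ht
  exact integral_abs_Theat_le hφ ht
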